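/- Let Γ be a group generated by a finite set S, F the free group on S, and π : F → Γ the induced epimorphism. Then Γ is weakly locally stable if and only if the system of equations {r = e : r ∈ ker π} is weakly locally stable in permutations. -/

import Mathlib

open Filter Topology

open scoped Classical

/-- Normalized Hamming metric on `Sym(k)`:
`d_k(σ,τ) = |{i : σ i ≠ τ i}| / k` (which equals `1 - |{i : σ i = τ i}|/k` for `k ≥ 1`). -/
noncomputable def dHam {k : ℕ} (σ τ : Equiv.Perm (Fin k)) : ℝ :=
  ((Finset.univ.filter fun i => σ i ≠ τ i).card : ℝ) / k

/-- `(φ_n)` is an almost-homomorphism. -/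
def IsAlmostHom {Γ : Type*} [Group Γ] (k : ℕ → ℕ)
    (φ : ∀ n, Γ → Equiv.Perm (Fin (k n))) : Prop :=
  ∀ g h : Γ,
    Tendsto (fun n => dHam (φ n g * φ n h) (φ n (g * h))) atTop (𝓝 0)

/-- `(φ_n)` is a partial homomorphism. -/
def IsPartialHom {Γ : Type*} [Group Γ] (k : ℕ → ℕ)
    (φ : ∀ n, Γ → Equiv.Perm (Fin (k n))) : Prop :=
  ∀ g h : Γ, ∀ᶠ n in atTop, φ n (g * h) = φ n g * φ n h

/-- `(φ_n)` is separating. -/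
def IsSeparating {Γ : Type*} [Group Γ] (k : ℕ → ℕ)
    (φ : ∀ n, Γ → Equiv.Perm (Fin (k n))) : Prop :=
  ∀ g : Γ, g ≠ 1 → Tendsto (fun n => dHam (φ n g) 1) atTop (𝓝 1)

/-- `(φ_n)` is a sequence of genuine homomorphisms. -/
def IsHomSeq {Γ : Type*} [Group Γ] (k : ℕ → ℕ)
    (φ : ∀ n, Γ → Equiv.Perm (Fin (k n))) : Prop :=
  ∀ n, ∀ g h : Γ, φ n (g * h) = φ n g * φ n h

/-- `(ψ_n)` is asymptotically close to `(φ_n)`: for every `g`, `d_{k_n}(φ_n g, ψ_n g) → 0`. -/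
def CloseSeq {Γ : Type*} [Group Γ] (k : ℕ → ℕ)
    (φ ψ : ∀ n, Γ → Equiv.Perm (Fin (k n))) : Prop :=
  ∀ g : Γ, Tendsto (fun n => dHam (φ n g) (ψ n g)) atTop (𝓝 0)

/-- `Γ` is locally stable. -/
def IsLocallyStable (Γ : Type*) [Group Γ] : Prop :=
  ∀ (k : ℕ → ℕ), (∀ n, 0 < k n) →
    ∀ φ : ∀ n, Γ → Equiv.Perm (Fin (k n)), IsAlmostHom k φ →
      ∃ ψ : ∀ n, Γ → Equiv.Perm (Fin (k n)), IsPartialHom k ψ ∧ CloseSeq k φ ψ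

/-- `Γ` is weakly locally stable. -/
def IsWeaklyLocallyStable (Γ : Type*) [Group Γ] : Prop :=
  ∀ (k : ℕ → ℕ), (∀ n, 0 < k n) →
    ∀ φ : ∀ n, Γ → Equiv.Perm (Fin (k n)), IsAlmostHom k φ → IsSeparating k φ →
      ∃ ψ : ∀ n, Γ → Equiv.Perm (Fin (k n)), IsPartialHom k ψ ∧ CloseSeq k φ ψ

/-- `Γ` is stable (in permutations). -/
def IsStable (Γ : Type*) [Group Γ] : Prop :=
  ∀ (k : ℕ → ℕ), (∀ n, 0 < k n) →
    ∀ φ : ∀ n, Γ → Equiv.Perm (Fin (k n)), IsAlmostHom k φ →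
      ∃ ψ : ∀ n, Γ → Equiv.Perm (Fin (k n)), IsHomSeq k ψ ∧ CloseSeq k φ ψ

/-- `Γ` is weakly stable. -/
def IsWeaklyStable (Γ : Type*) [Group Γ] : Prop :=
  ∀ (k : ℕ → ℕ), (∀ n, 0 < k n) →
    ∀ φ : ∀ n, Γ → Equiv.Perm (Fin (k n)), IsAlmostHom k φ → IsSeparating k φ →
      ∃ ψ : ∀ n, Γ → Equiv.Perm (Fin (k n)), IsHomSeq k ψ ∧ CloseSeq k φ ψ

/-- `Γ` is sofic: it admits a separating almost-homomorphism. -/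
def IsSofic (Γ : Type*) [Group Γ] : Prop :=
  ∃ (k : ℕ → ℕ), (∀ n, 0 < k n) ∧
    ∃ φ : ∀ n, Γ → Equiv.Perm (Fin (k n)), IsAlmostHom k φ ∧ IsSeparating k φ

/-- `Γ` is LEF: it admits a separating partial homomorphism. -/
def IsLEF (Γ : Type*) [Group Γ] : Prop :=
  ∃ (k : ℕ → ℕ), (∀ n, 0 < k n) ∧
    ∃ φ : ∀ n, Γ → Equiv.Perm (Fin (k n)), IsPartialHom k φ ∧ IsSeparating k φ

/-- For `N` a normal subgroup of the free group on the finite set `ι`, the system of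
equations `{r = e : r ∈ N}` is weakly locally stable in permutations. -/
def EqnWeaklyLocallyStable {ι : Type} [Fintype ι] (N : Subgroup (FreeGroup ι)) : Prop :=
  ∀ ε : ℝ, 0 < ε → ∀ R₀ : Finset (FreeGroup ι), ↑R₀ ⊆ (N : Set (FreeGroup ι)) →
    ∃ δ : ℝ, 0 < δ ∧ ∃ R₁ R₁' : Finset (FreeGroup ι),
      ↑R₁ ⊆ (N : Set (FreeGroup ι)) ∧ (∀ w ∈ R₁', w ∉ N) ∧
      ∀ (k : ℕ) (σ : ι → Equiv.Perm (Fin k)),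
        (∀ r ∈ R₁, dHam (FreeGroup.lift σ r) 1 < δ) →
        (∀ w ∈ R₁', 1 - δ < dHam (FreeGroup.lift σ w) 1) →
        ∃ τ : ι → Equiv.Perm (Fin k),
          (∀ r ∈ R₀, FreeGroup.lift τ r = 1) ∧
          ∑ i : ι, dHam (σ i) (τ i) < ε

section HammingMetric

variable {k : ℕ}

lemma dHam_self (a : Equiv.Perm (Fin k)) : dHam a a = 0 := by
  simp [dHam]

lemma dHam_nonneg (a b : Equiv.Perm (Fin k)) : 0 ≤ dHam a b := by
  unfold dHam; positivity

lemma dHam_le_one (a b : Equiv.Perm (Fin k)) : dHam a b ≤ 1 := by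
  unfold dHam
  refine div_le_one_of_le₀ ?_ (Nat.cast_nonneg _)
  exact_mod_cast (Finset.card_le_univ _).trans_eq (Fintype.card_fin k)

lemma dHam_comm (a b : Equiv.Perm (Fin k)) : dHam a b = dHam b a := by
  simp only [dHam, ne_comm]

lemma dHam_triangle (a b c : Equiv.Perm (Fin k)) : dHam a c ≤ dHam a b + dHam b c := by
  unfold dHam
  rw [← add_div]
  gcongr
  rw [← Nat.cast_add, Nat.cast_le]
  refine le_trans (Finset.card_le_card ?_) (Finset.card_union_le _ _)
  intro i hi
  simp only [Finset.mem_union, Finset.mem_filter, Finset.mem_univ, true_and] at hi ⊢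
  by_contra! h
  exact hi (h.1.trans h.2)

lemma dHam_mul_left (c a b : Equiv.Perm (Fin k)) : dHam (c * a) (c * b) = dHam a b := by
  simp [dHam]

lemma dHam_mul_right (c a b : Equiv.Perm (Fin k)) : dHam (a * c) (b * c) = dHam a b := by
  unfold dHam
  congr 2
  refine Finset.card_bij (fun i _ => c i) ?_ ?_ ?_
  · intro i hi
    rw [Finset.mem_filter] at hi ⊢
    simpa using hi
  · intro i _ j _ h
    exact c.injective h
  · intro j hj
    rw [Finset.mem_filter] at hj
    exact ⟨c.symm j, by rw [Finset.mem_filter]; simpa using hj, by simp⟩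

lemma dHam_mul_le (a b c d : Equiv.Perm (Fin k)) :
    dHam (a * b) (c * d) ≤ dHam a c + dHam b d := by
  have h := dHam_triangle (a * b) (c * b) (c * d)
  rwa [dHam_mul_right, dHam_mul_left] at h

lemma dHam_inv_inv (a b : Equiv.Perm (Fin k)) : dHam a⁻¹ b⁻¹ = dHam a b := by
  rw [← dHam_mul_left a, ← dHam_mul_right b, dHam_comm]
  simp

lemma dHam_mul_inv_one (a b : Equiv.Perm (Fin k)) : dHam (a * b⁻¹) 1 = dHam a b := by
  rw [← dHam_mul_right b]
  simp

lemma dHam_inv_left (a b : Equiv.Perm (Fin k)) : dHam a⁻¹ b = dHam (a * b) 1 := by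
  rw [← dHam_mul_left a, dHam_comm]
  simp

end HammingMetric

section Sequences

variable {ι Γ : Type*} [Group Γ] {k : ℕ → ℕ}

lemma tendsto_dHam_trans {a b c : ∀ n, Equiv.Perm (Fin (k n))}
    (hab : Tendsto (fun n => dHam (a n) (b n)) atTop (𝓝 0))
    (hbc : Tendsto (fun n => dHam (b n) (c n)) atTop (𝓝 0)) :
    Tendsto (fun n => dHam (a n) (c n)) atTop (𝓝 0) :=
  squeeze_zero (fun _ => dHam_nonneg _ _) (fun n => dHam_triangle _ (b n) _)
    (by simpa using hab.add hbc)

lemma tendsto_dHam_mul {a b c d : ∀ n, Equiv.Perm (Fin (k n))}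
    (hac : Tendsto (fun n => dHam (a n) (c n)) atTop (𝓝 0))
    (hbd : Tendsto (fun n => dHam (b n) (d n)) atTop (𝓝 0)) :
    Tendsto (fun n => dHam (a n * b n) (c n * d n)) atTop (𝓝 0) :=
  squeeze_zero (fun _ => dHam_nonneg _ _) (fun n => dHam_mul_le _ _ _ _)
    (by simpa using hac.add hbd)

lemma tendsto_dHam_symm {a b : ∀ n, Equiv.Perm (Fin (k n))}
    (hab : Tendsto (fun n => dHam (a n) (b n)) atTop (𝓝 0)) :
    Tendsto (fun n => dHam (b n) (a n)) atTop (𝓝 0) := by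
  simpa only [dHam_comm] using hab

lemma tendsto_dHam_one_of_tendsto {a b : ∀ n, Equiv.Perm (Fin (k n))}
    (hab : Tendsto (fun n => dHam (a n) (b n)) atTop (𝓝 0))
    (hb : Tendsto (fun n => dHam (b n) 1) atTop (𝓝 1)) :
    Tendsto (fun n => dHam (a n) 1) atTop (𝓝 1) := by
  refine tendsto_of_tendsto_of_tendsto_of_le_of_le
    (g := fun n => dHam (b n) 1 - dHam (a n) (b n)) (by simpa using hb.sub hab)
    tendsto_const_nhds (fun n => ?_) (fun n => dHam_le_one _ _)
  have h := dHam_triangle (b n) (a n) 1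
  rw [dHam_comm (b n) (a n)] at h
  linarith

lemma IsAlmostHom.tendsto_map_one {φ : ∀ n, Γ → Equiv.Perm (Fin (k n))}
    (hφ : IsAlmostHom k φ) : Tendsto (fun n => dHam (φ n 1) 1) atTop (𝓝 0) := by
  refine (hφ 1 1).congr fun n => ?_
  simpa using dHam_mul_left (φ n 1) (φ n 1) 1

lemma IsAlmostHom.tendsto_lift {φ : ∀ n, Γ → Equiv.Perm (Fin (k n))}
    (hφ : IsAlmostHom k φ) (f : ι → Γ) (w : FreeGroup ι) :
    Tendsto (fun n => dHam (FreeGroup.lift (fun i => φ n (f i)) w) (φ n (FreeGroup.lift f w)))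
      atTop (𝓝 0) := by
  induction w using FreeGroup.induction_on with
  | C1 => simpa using tendsto_dHam_symm hφ.tendsto_map_one
  | of i => simp [dHam_self]
  | inv_of i _ =>
    have h := tendsto_dHam_trans (c := fun _ => 1) (hφ (f i) (f i)⁻¹)
      (by simpa using hφ.tendsto_map_one)
    simpa [dHam_inv_left] using h
  | mul x y hx hy =>
    simpa using tendsto_dHam_trans (tendsto_dHam_mul hx hy)
      (hφ (FreeGroup.lift f x) (FreeGroup.lift f y))

lemma tendsto_dHam_lift {σ τ : ∀ n, ι → Equiv.Perm (Fin (k n))}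
    (h : ∀ i, Tendsto (fun n => dHam (σ n i) (τ n i)) atTop (𝓝 0)) (w : FreeGroup ι) :
    Tendsto (fun n => dHam (FreeGroup.lift (σ n) w) (FreeGroup.lift (τ n) w)) atTop (𝓝 0) := by
  induction w using FreeGroup.induction_on with
  | C1 => simp [dHam_self]
  | of i => simpa using h i
  | inv_of i _ => simpa [dHam_inv_inv] using h i
  | mul x y hx hy => simpa using tendsto_dHam_mul hx hy

lemma IsPartialHom.eventually_map_one {ψ : ∀ n, Γ → Equiv.Perm (Fin (k n))}
    (hψ : IsPartialHom k ψ) : ∀ᶠ n in atTop, ψ n 1 = 1 := by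
  filter_upwards [hψ 1 1] with n hn
  simpa using hn

lemma IsPartialHom.eventually_lift {ψ : ∀ n, Γ → Equiv.Perm (Fin (k n))}
    (hψ : IsPartialHom k ψ) (f : ι → Γ) (w : FreeGroup ι) :
    ∀ᶠ n in atTop, FreeGroup.lift (fun i => ψ n (f i)) w = ψ n (FreeGroup.lift f w) := by
  induction w using FreeGroup.induction_on with
  | C1 => simpa [eq_comm] using hψ.eventually_map_one
  | of i => simp
  | inv_of i _ =>
    filter_upwards [hψ (f i) (f i)⁻¹, hψ.eventually_map_one] with n h h1
    rw [mul_inv_cancel, h1] at h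
    simpa using inv_eq_of_mul_eq_one_right h.symm
  | mul x y hx hy =>
    filter_upwards [hx, hy, hψ (FreeGroup.lift f x) (FreeGroup.lift f y)] with n h1 h2 h3
    simp [h1, h2, h3]

end Sequences

lemma exists_seq_forall_eventually {α : ℕ → Type*} [∀ n, Nonempty (α n)]
    {P : ℕ → ∀ n, α n → Prop} (hanti : ∀ n x i j, i ≤ j → P j n x → P i n x)
    (h : ∀ j, ∀ᶠ n in atTop, ∃ x, P j n x) :
    ∃ x : ∀ n, α n, ∀ j, ∀ᶠ n in atTop, P j n (x n) := by
  let J : ℕ → ℕ := fun n => Nat.findGreatest (fun j => ∃ x, P j n x) n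
  have key : ∀ n, ∃ x, (∃ x, P (J n) n x) → P (J n) n x := fun n => by
    by_cases hn : ∃ x, P (J n) n x
    · exact ⟨hn.choose, fun _ => hn.choose_spec⟩
    · exact ⟨Classical.arbitrary _, fun h => absurd h hn⟩
  choose x hx using key
  refine ⟨x, fun j => ?_⟩
  filter_upwards [h j, eventually_ge_atTop j] with n hn hjn
  exact hanti n _ _ _ (Nat.le_findGreatest hjn hn)
    (hx n (Nat.findGreatest_spec (P := fun j => ∃ x, P j n x) hjn hn))

/-- The finite subset of `T` consisting of its elements with code less than `n`. -/
noncomputable def initialPart {α : Type*} [Encodable α] (T : Set α) (n : ℕ) : Finset α :=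
  ((Finset.range n).biUnion fun m => (Encodable.decode (α := α) m).toFinset).filter (· ∈ T)

section InitialPart

variable {α : Type*} [Encodable α] {T : Set α}

lemma mem_of_mem_initialPart {n : ℕ} {a : α} (h : a ∈ initialPart T n) : a ∈ T :=
  (Finset.mem_filter.1 h).2

lemma initialPart_mono : Monotone (initialPart T) := fun _ _ h =>
  Finset.filter_subset_filter _
    (Finset.biUnion_subset_biUnion_of_subset_left _ (Finset.range_mono h))

lemma mem_initialPart {a : α} (ha : a ∈ T) {n : ℕ} (hn : Encodable.encode a < n) :
    a ∈ initialPart T n :=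
  Finset.mem_filter.2 ⟨Finset.mem_biUnion.2 ⟨_, Finset.mem_range.2 hn, by simp⟩, ha⟩

end InitialPart

section Equivalence

variable {ι Γ : Type} [Fintype ι] [Group Γ] {f : ι → Γ}

lemma IsWeaklyLocallyStable.eqn (hf : Function.Surjective (FreeGroup.lift f))
    (hΓ : IsWeaklyLocallyStable Γ) : EqnWeaklyLocallyStable (FreeGroup.lift f).ker := by
  intro ε hε R₀ hR₀
  by_contra hcon
  let _ : Encodable (FreeGroup ι) := Encodable.ofCountable _
  set N : Set (FreeGroup ι) := ↑(FreeGroup.lift f).ker with hN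
  have key : ∀ n : ℕ, ∃ (k : ℕ) (σ : ι → Equiv.Perm (Fin k)),
      (∀ r ∈ initialPart N n, dHam (FreeGroup.lift σ r) 1 < 1 / ((n : ℝ) + 1)) ∧
      (∀ w ∈ initialPart Nᶜ n, 1 - 1 / ((n : ℝ) + 1) < dHam (FreeGroup.lift σ w) 1) ∧
      ∀ τ : ι → Equiv.Perm (Fin k), (∀ r ∈ R₀, FreeGroup.lift τ r = 1) →
        ε ≤ ∑ i, dHam (σ i) (τ i) := by
    intro n
    by_contra! h
    exact hcon ⟨1 / ((n : ℝ) + 1), by positivity, initialPart N n, initialPart Nᶜ n,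
      fun _ hr => mem_of_mem_initialPart hr, fun _ hw => mem_of_mem_initialPart hw, h⟩
  choose k σ hker hsep hbad using key
  have hk : ∀ n, 0 < k n := by
    intro n
    by_contra h0
    have : IsEmpty (Fin (k n)) := by
      rw [Nat.eq_zero_of_not_pos h0]; infer_instance
    have h := hbad n (σ n) fun r _ => Subsingleton.elim _ _
    simp only [dHam_self, Finset.sum_const_zero] at h
    exact hε.not_ge h
  have hlim : Tendsto (fun n : ℕ => 1 / ((n : ℝ) + 1)) atTop (𝓝 0) :=
    tendsto_one_div_add_atTop_nhds_zero_nat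
  have hkerlim : ∀ r ∈ N, Tendsto (fun n => dHam (FreeGroup.lift (σ n) r) 1) atTop (𝓝 0) := by
    intro r hr
    refine squeeze_zero' (Eventually.of_forall fun _ => dHam_nonneg _ _) ?_ hlim
    filter_upwards [eventually_gt_atTop (Encodable.encode r)] with n hn
    exact (hker n r (mem_initialPart hr hn)).le
  have hseplim : ∀ w ∉ N, Tendsto (fun n => dHam (FreeGroup.lift (σ n) w) 1) atTop (𝓝 1) := by
    intro w hw
    refine tendsto_of_tendsto_of_tendsto_of_le_of_le'
      (g := fun n : ℕ => 1 - 1 / ((n : ℝ) + 1)) (by simpa using hlim.const_sub 1)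
      tendsto_const_nhds ?_ (Eventually.of_forall fun _ => dHam_le_one _ _)
    filter_upwards [eventually_gt_atTop (Encodable.encode w)] with n hn
    exact (hsep n w (mem_initialPart hw hn)).le
  have hclose : ∀ v w, FreeGroup.lift f v = FreeGroup.lift f w →
      Tendsto (fun n => dHam (FreeGroup.lift (σ n) v) (FreeGroup.lift (σ n) w))
        atTop (𝓝 0) := by
    intro v w h
    have hmem : v * w⁻¹ ∈ N := by
      simp [hN, MonoidHom.mem_ker, h]
    simpa [dHam_mul_inv_one] using hkerlim _ hmem
  choose s hs using hf
  obtain ⟨ψ, hψ, hφψ⟩ := hΓ k hk (fun n g => FreeGroup.lift (σ n) (s g))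
    (fun g h => by simpa using hclose (s g * s h) (s (g * h)) (by simp [hs]))
    (fun g hg => hseplim _ (by simpa [hN, MonoidHom.mem_ker, hs] using hg))
  have hsol : ∀ᶠ n in atTop, ∀ r ∈ R₀, FreeGroup.lift (fun i => ψ n (f i)) r = 1 := by
    rw [Filter.eventually_all_finset]
    intro r hr
    filter_upwards [hψ.eventually_lift f r, hψ.eventually_map_one] with n h h1
    rw [h, MonoidHom.mem_ker.1 (hR₀ hr), h1]
  have hsum : Tendsto (fun n => ∑ i, dHam (σ n i) (ψ n (f i))) atTop (𝓝 0) := by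
    have h : ∀ i ∈ Finset.univ,
        Tendsto (fun n => dHam (σ n i) (ψ n (f i))) atTop (𝓝 0) := fun i _ =>
      tendsto_dHam_trans
        (by simpa using hclose (FreeGroup.of i) (s (f i)) (by simp [hs])) (hφψ (f i))
    simpa using tendsto_finsetSum _ h
  obtain ⟨n, h1, h2⟩ := (hsol.and (hsum.eventually_lt_const hε)).exists
  exact (hbad n _ h1).not_gt h2

lemma EqnWeaklyLocallyStable.isWeaklyLocallyStable
    (hf : Function.Surjective (FreeGroup.lift f))
    (hN : EqnWeaklyLocallyStable (FreeGroup.lift f).ker) : IsWeaklyLocallyStable Γ := by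
  intro k _ φ hφ hφsep
  let _ : Encodable (FreeGroup ι) := Encodable.ofCountable _
  set N : Set (FreeGroup ι) := ↑(FreeGroup.lift f).ker with hNdef
  have hlift := hφ.tendsto_lift f
  have hsol : ∀ j : ℕ, ∀ᶠ n in atTop, ∃ τ : ι → Equiv.Perm (Fin (k n)),
      (∀ r ∈ initialPart N j, FreeGroup.lift τ r = 1) ∧
        ∑ i, dHam (φ n (f i)) (τ i) < 1 / ((j : ℝ) + 1) := by
    intro j
    obtain ⟨δ, hδ, R₁, R₁', hR₁, hR₁', h⟩ := hN (1 / ((j : ℝ) + 1)) (by positivity)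
      (initialPart N j) fun _ hr => mem_of_mem_initialPart hr
    have h1 : ∀ᶠ n in atTop, ∀ r ∈ R₁,
        dHam (FreeGroup.lift (fun i => φ n (f i)) r) 1 < δ := by
      rw [Filter.eventually_all_finset]
      intro r hr
      refine (tendsto_dHam_trans (hlift r) ?_).eventually_lt_const hδ
      rw [MonoidHom.mem_ker.1 (hR₁ hr)]
      exact hφ.tendsto_map_one
    have h2 : ∀ᶠ n in atTop, ∀ w ∈ R₁',
        1 - δ < dHam (FreeGroup.lift (fun i => φ n (f i)) w) 1 := by
      rw [Filter.eventually_all_finset]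
      intro w hw
      exact (tendsto_dHam_one_of_tendsto (hlift w)
        (hφsep _ fun h => hR₁' w hw (MonoidHom.mem_ker.2 h))).eventually_const_lt (by linarith)
    filter_upwards [h1, h2] with n h1 h2
    exact h (k n) _ h1 h2
  obtain ⟨τ, hτ⟩ := exists_seq_forall_eventually
    (fun n τ i j hij hj => ⟨fun r hr => hj.1 r (initialPart_mono hij hr),
      hj.2.trans_le (Nat.one_div_le_one_div hij)⟩) hsol
  have hker : ∀ r ∈ N, ∀ᶠ n in atTop, FreeGroup.lift (τ n) r = 1 := by
    intro r hr
    filter_upwards [hτ (Encodable.encode r + 1)] with n hn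
    exact hn.1 r (mem_initialPart hr (Nat.lt_succ_self _))
  have hgen : ∀ i, Tendsto (fun n => dHam (φ n (f i)) (τ n i)) atTop (𝓝 0) := by
    intro i
    refine tendsto_order.2 ⟨fun a ha => Eventually.of_forall fun n =>
      ha.trans_le (dHam_nonneg _ _), fun a ha => ?_⟩
    obtain ⟨j, hj⟩ := exists_nat_one_div_lt ha
    filter_upwards [hτ j] with n hn
    exact (Finset.single_le_sum (f := fun i => dHam (φ n (f i)) (τ n i))
      (fun _ _ => dHam_nonneg _ _) (Finset.mem_univ i)).trans_lt (hn.2.trans hj)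
  choose s hs using hf
  refine ⟨fun n g => FreeGroup.lift (τ n) (s g), fun g h => ?_, fun g => ?_⟩
  · filter_upwards [hker (s (g * h) * (s g * s h)⁻¹)
      (by simp [hNdef, MonoidHom.mem_ker, hs])] with n hn
    rw [map_mul, map_inv, mul_inv_eq_one] at hn
    simpa using hn
  · have h := tendsto_dHam_symm (hlift (s g))
    rw [hs] at h
    exact tendsto_dHam_trans h (tendsto_dHam_lift hgen (s g))

end Equivalence

/-- `Γ` (generated by the finite set `S`, with `π` the epimorphism from the free group
on `S`) is weakly locally stable iff the system of equations `{r = e : r ∈ ker π}` is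
weakly locally stable in permutations. -/
theorem weaklyLocallyStable_iff_eqnWeaklyLocallyStable (Γ : Type) [Group Γ]
    (S : Finset Γ) (hS : Subgroup.closure (S : Set Γ) = ⊤) :
    IsWeaklyLocallyStable Γ ↔
      EqnWeaklyLocallyStable (FreeGroup.lift fun s : ↥S => (s : Γ)).ker := by
  have hf : Function.Surjective (FreeGroup.lift fun s : ↥S => (s : Γ)) := by
    rw [← MonoidHom.range_eq_top, FreeGroup.range_lift_eq_closure, ← hS]
    simp
  exact ⟨fun h => h.eqn hf, fun h => h.isWeaklyLocallyStable hf⟩
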